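/- Let λ = a + bi and μ be complex numbers with Im λ ≥ 0 and Im μ ≥ 0, and let J^ℝ denote real Jordan blocks. (1) If λ ≠ μ, then for every real matrix M of size p×q (p the size of J^ℝ_p(λ), q the size of J^ℝ_q(μ), with p even if Im λ > 0 and q even if Im μ > 0) there exists a real S with M + S J^ℝ_q(μ) − J^ℝ_p(λ) S = 0. (2) If λ = μ with b = Im λ > 0 and p = 2m, q = 2n, then for every M ∈ ℝ^{2m×2n} there exist S ∈ ℝ^{2m×2n} and a matrix H ∈ ℝ^{2m×2n} of form (5.1) such that M + S J^ℝ_{2n}(λ) − J^ℝ_{2m}(λ) S = H; moreover H is uniquely determined by M. -/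

import Mathlib

open Matrix Complex

/-- Entry `(x, y)` (0-indexed) of the real Jordan block `J^ℝ_r(lam)`.
For real `lam` this is the usual Jordan block entry; for `lam = a + b i` with `b ≠ 0`
it is the entry of the block-tridiagonal matrix with `2×2` diagonal blocks
`T_{ab} = [[a, b], [−b, a]]` and `I_2` blocks on the block superdiagonal. -/
noncomputable def realJordanEntry (lam : ℂ) (x y : ℕ) : ℝ :=
  if lam.im = 0 then
    (if x = y then lam.re else if y = x + 1 then 1 else 0)
  else if x / 2 = y / 2 then
    (if x % 2 = y % 2 then lam.re else if x % 2 = 0 then lam.im else -lam.im)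
  else if y / 2 = x / 2 + 1 ∧ x % 2 = y % 2 then 1 else 0

/-- The real Jordan block `J^ℝ_r(lam)`. -/
noncomputable def realJordanBlock (r : ℕ) (lam : ℂ) : Matrix (Fin r) (Fin r) ℝ :=
  Matrix.of fun i j => realJordanEntry lam (i : ℕ) (j : ℕ)

/-- A `p × q` matrix `H` is of form (5.1) if: in case `p ≤ q` all entries outside its
first column are zero, and in case `p > q` all entries outside its last row are zero. -/
def IsForm51 {p q : ℕ} (H : Matrix (Fin p) (Fin q) ℝ) : Prop :=
  if p ≤ q then ∀ (i : Fin p) (j : Fin q), (j : ℕ) ≠ 0 → H i j = 0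
  else ∀ (i : Fin p) (j : Fin q), (i : ℕ) ≠ p - 1 → H i j = 0

/-- Extension by zero of a finite vector to a sequence. -/
def seqExtend {r : ℕ} (w : Fin r → ℝ) : ℕ → ℝ :=
  fun x => if h : x < r then w ⟨x, h⟩ else 0

/-- The action of the infinite real Jordan block on sequences. -/
noncomputable def jordanOp (lam : ℂ) (f : ℕ → ℝ) : ℕ → ℝ := fun x =>
  if lam.im = 0 then lam.re * f x + f (x + 1)
  else if x % 2 = 0 then lam.re * f x + lam.im * f (x + 1) + f (x + 2)
  else lam.re * f x - lam.im * f (x - 1) + f (x + 2)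

lemma seqExtend_val {r : ℕ} (w : Fin r → ℝ) (i : Fin r) : seqExtend w i = w i := by
  simp [seqExtend]

lemma seqExtend_of_le {r : ℕ} (w : Fin r → ℝ) {x : ℕ} (h : r ≤ x) : seqExtend w x = 0 := by
  simp [seqExtend, h]

lemma seqExtend_injective {r : ℕ} : Function.Injective (seqExtend (r := r)) := by
  intro v w h
  ext i
  rw [← seqExtend_val v, ← seqExtend_val w, h]

lemma seqExtend_add {r : ℕ} (v w : Fin r → ℝ) (x : ℕ) :
    seqExtend (v + w) x = seqExtend v x + seqExtend w x := by
  by_cases h : x < r <;> simp [seqExtend, h]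

lemma seqExtend_smul {r : ℕ} (c : ℝ) (w : Fin r → ℝ) (x : ℕ) :
    seqExtend (c • w) x = c * seqExtend w x := by
  by_cases h : x < r <;> simp [seqExtend, h]

lemma realJordanEntry_eq_of_im_eq_zero {lam : ℂ} (h : lam.im = 0) (x y : ℕ) :
    realJordanEntry lam x y =
      (if y = x then lam.re else 0) + (if y = x + 1 then 1 else 0) := by
  unfold realJordanEntry
  rw [if_pos h]
  split_ifs <;> first | omega | simp

lemma realJordanEntry_eq_of_even {lam : ℂ} (h : lam.im ≠ 0) {x : ℕ} (hx : x % 2 = 0) (y : ℕ) :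
    realJordanEntry lam x y = (if y = x then lam.re else 0) +
      (if y = x + 1 then lam.im else 0) + (if y = x + 2 then 1 else 0) := by
  unfold realJordanEntry
  rw [if_neg h]
  split_ifs <;> first | omega | simp

lemma realJordanEntry_eq_of_odd {lam : ℂ} (h : lam.im ≠ 0) {x : ℕ} (hx : x % 2 ≠ 0) (y : ℕ) :
    realJordanEntry lam x y = (if y = x then lam.re else 0) +
      (if y = x - 1 then -lam.im else 0) + (if y = x + 2 then 1 else 0) := by
  unfold realJordanEntry
  rw [if_neg h]
  split_ifs <;> first | omega | simp

lemma sum_range_ite_mul_seqExtend {r : ℕ} (w : Fin r → ℝ) (c : ℝ) (k : ℕ) :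
    ∑ y ∈ Finset.range r, (if y = k then c else 0) * seqExtend w y = c * seqExtend w k := by
  simp_rw [ite_mul, zero_mul, Finset.sum_ite_eq', Finset.mem_range]
  split_ifs with h
  · rfl
  · rw [seqExtend_of_le _ (not_lt.1 h), mul_zero]

lemma seqExtend_realJordanBlock_mulVec {lam : ℂ} {r : ℕ} (hr : lam.im ≠ 0 → Even r)
    (w : Fin r → ℝ) :
    seqExtend (realJordanBlock r lam *ᵥ w) = jordanOp lam (seqExtend w) := by
  funext x
  by_cases hx : x < r
  · have h1 : seqExtend (realJordanBlock r lam *ᵥ w) x =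
        ∑ y ∈ Finset.range r, realJordanEntry lam x y * seqExtend w y := by
      rw [← Fin.sum_univ_eq_sum_range (fun y => realJordanEntry lam x y * seqExtend w y)]
      simp [seqExtend, hx, realJordanBlock, Matrix.mulVec, dotProduct]
    rw [h1, jordanOp]
    split_ifs with h0 h2
    · simp_rw [realJordanEntry_eq_of_im_eq_zero h0, add_mul, Finset.sum_add_distrib,
        sum_range_ite_mul_seqExtend, one_mul]
    · simp_rw [realJordanEntry_eq_of_even h0 h2, add_mul, Finset.sum_add_distrib,
        sum_range_ite_mul_seqExtend, one_mul]
    · simp_rw [realJordanEntry_eq_of_odd h0 h2, add_mul, Finset.sum_add_distrib,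
        sum_range_ite_mul_seqExtend, one_mul]
      ring
  · rw [seqExtend_of_le _ (not_lt.1 hx), jordanOp]
    split_ifs with h0 h2
    · rw [seqExtend_of_le _ (by omega), seqExtend_of_le _ (by omega)]; simp
    · rw [seqExtend_of_le _ (by omega), seqExtend_of_le _ (by omega),
        seqExtend_of_le _ (by omega)]; simp
    · obtain ⟨k, hk⟩ := hr h0
      rw [seqExtend_of_le _ (by omega), seqExtend_of_le _ (by omega),
        seqExtend_of_le _ (by omega)]; simp

/-- The real quadratic polynomial with roots `lam` and its conjugate. -/
noncomputable def conjRootsPoly (lam : ℂ) : Polynomial ℝ :=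
  (Polynomial.X - Polynomial.C lam.re) ^ 2 + Polynomial.C lam.im ^ 2

lemma aeval_conjRootsPoly_mulVec (lam : ℂ) {r : ℕ} (A : Matrix (Fin r) (Fin r) ℝ)
    (w : Fin r → ℝ) :
    Polynomial.aeval A (conjRootsPoly lam) *ᵥ w =
      A *ᵥ (A *ᵥ w) + (-(2 * lam.re)) • (A *ᵥ w) + (lam.re ^ 2 + lam.im ^ 2) • w := by
  have h : conjRootsPoly lam = Polynomial.X * Polynomial.X +
      (-(2 * lam.re)) • Polynomial.X + (lam.re ^ 2 + lam.im ^ 2) • 1 := by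
    simp only [conjRootsPoly, Polynomial.smul_eq_C_mul, map_neg, map_mul, map_add, map_pow,
      map_ofNat]
    ring
  rw [h]
  simp only [map_add, map_mul, map_smul, Polynomial.aeval_X, map_one, Matrix.add_mulVec,
    Matrix.smul_mulVec, Matrix.one_mulVec, Matrix.mulVec_mulVec]

lemma seqExtend_aeval_conjRootsPoly_mulVec {lam : ℂ} {r : ℕ} (hr : lam.im ≠ 0 → Even r)
    (w : Fin r → ℝ) (x : ℕ) :
    seqExtend (Polynomial.aeval (realJordanBlock r lam) (conjRootsPoly lam) *ᵥ w) x =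
      if lam.im = 0 then seqExtend w (x + 2)
      else if x % 2 = 0 then 2 * lam.im * seqExtend w (x + 3) + seqExtend w (x + 4)
      else -(2 * lam.im) * seqExtend w (x + 1) + seqExtend w (x + 4) := by
  rw [aeval_conjRootsPoly_mulVec, seqExtend_add, seqExtend_add, seqExtend_smul, seqExtend_smul,
    seqExtend_realJordanBlock_mulVec hr, seqExtend_realJordanBlock_mulVec hr]
  split_ifs with h0 h2
  · simp only [jordanOp, h0, if_true]
    ring
  · have h3 : (x + 1) % 2 ≠ 0 := by omega
    have h4 : (x + 2) % 2 = 0 := by omega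
    simp only [jordanOp, h0, if_false, h2, h3, h4, if_true, Nat.add_sub_cancel]
    ring
  · obtain ⟨y, rfl⟩ : ∃ y, x = y + 1 := ⟨x - 1, by omega⟩
    have h3 : y % 2 = 0 := by omega
    have h4 : (y + 1 + 2) % 2 ≠ 0 := by omega
    have h5 : y + 1 + 2 - 1 = y + 2 := by omega
    simp only [jordanOp, h0, if_false, h2, h3, h4, h5, if_true, Nat.add_sub_cancel]
    ring

lemma aeval_conjRootsPoly_pow_eq_zero {lam : ℂ} {r : ℕ} (hr : lam.im ≠ 0 → Even r) :
    Polynomial.aeval (realJordanBlock r lam) (conjRootsPoly lam ^ r) = 0 := by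
  rw [map_pow]
  set N := Polynomial.aeval (realJordanBlock r lam) (conjRootsPoly lam) with hN
  have key : ∀ (k : ℕ) (w : Fin r → ℝ) (x : ℕ), r ≤ x + k → seqExtend (N ^ k *ᵥ w) x = 0 := by
    intro k
    induction k with
    | zero => intro w x hx; exact seqExtend_of_le _ (by omega)
    | succ k ih =>
      intro w x hx
      rw [pow_succ', ← Matrix.mulVec_mulVec, hN, seqExtend_aeval_conjRootsPoly_mulVec hr, ← hN]
      split_ifs
      · exact ih _ _ (by omega)
      · rw [ih _ _ (by omega), ih _ _ (by omega)]; simp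
      · rw [ih _ _ (by omega), ih _ _ (by omega)]; simp
  apply Matrix.ext_of_mulVec_single
  intro i
  apply seqExtend_injective
  funext x
  rw [key r _ x (by omega)]
  simp [seqExtend]

lemma isCoprime_conjRootsPoly {lam mu : ℂ} (hlam : 0 ≤ lam.im) (hmu : 0 ≤ mu.im)
    (h : lam ≠ mu) : IsCoprime (conjRootsPoly lam) (conjRootsPoly mu) := by
  rw [Polynomial.isCoprime_iff_aeval_ne_zero_of_isAlgClosed ℝ ℂ]
  intro z
  by_contra! hz
  have root : ∀ l : ℂ, Polynomial.aeval z (conjRootsPoly l) = 0 →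
      z.re = l.re ∧ z.im ^ 2 = l.im ^ 2 := by
    intro l hl
    have h1 : (z - l.re - l.im * I) * (z - l.re + l.im * I) = 0 := by
      have h2 : (z - l.re) ^ 2 + (l.im : ℂ) ^ 2 = 0 := by simpa [conjRootsPoly] using hl
      linear_combination h2 - (l.im : ℂ) ^ 2 * I_sq
    rcases mul_eq_zero.1 h1 with h2 | h2
    · have hr := congrArg Complex.re h2
      have hi := congrArg Complex.im h2
      simp at hr hi
      exact ⟨by linarith, by rw [sub_eq_zero.1 hi]⟩
    · have hr := congrArg Complex.re h2
      have hi := congrArg Complex.im h2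
      simp at hr hi
      exact ⟨by linarith, by rw [eq_neg_of_add_eq_zero_left hi, neg_sq]⟩
  obtain ⟨h1, h2⟩ := root lam hz.1
  obtain ⟨h3, h4⟩ := root mu hz.2
  exact h (Complex.ext (h1.symm.trans h3) ((sq_eq_sq₀ hlam hmu).1 (h2.symm.trans h4)))

/-- The Sylvester operator `S ↦ S * B - A * S`. -/
def sylvesterMap {p q : ℕ} (A : Matrix (Fin p) (Fin p) ℝ) (B : Matrix (Fin q) (Fin q) ℝ) :
    Matrix (Fin p) (Fin q) ℝ →ₗ[ℝ] Matrix (Fin p) (Fin q) ℝ where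
  toFun S := S * B - A * S
  map_add' S T := by rw [Matrix.add_mul, Matrix.mul_add]; abel
  map_smul' c S := by simp [smul_sub]

lemma sylvesterMap_apply {p q : ℕ} (A : Matrix (Fin p) (Fin p) ℝ) (B : Matrix (Fin q) (Fin q) ℝ)
    (S : Matrix (Fin p) (Fin q) ℝ) : sylvesterMap A B S = S * B - A * S := rfl

lemma mul_aeval_eq_aeval_mul {p q : ℕ} {A : Matrix (Fin p) (Fin p) ℝ}
    {B : Matrix (Fin q) (Fin q) ℝ} {S : Matrix (Fin p) (Fin q) ℝ} (h : S * B = A * S)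
    (f : Polynomial ℝ) : S * Polynomial.aeval B f = Polynomial.aeval A f * S := by
  induction f using Polynomial.induction_on' with
  | add f g hf hg => rw [map_add, map_add, Matrix.mul_add, Matrix.add_mul, hf, hg]
  | monomial n c =>
    have hpow : S * B ^ n = A ^ n * S := by
      induction n with
      | zero => simp
      | succ n ih => rw [pow_succ, ← Matrix.mul_assoc, ih, Matrix.mul_assoc, h,
          ← Matrix.mul_assoc, ← pow_succ]
    simp [Polynomial.aeval_monomial, Algebra.algebraMap_eq_smul_one, hpow]

/-- The Sylvester operator is surjective if its coefficients are annihilated by coprime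
polynomials. -/
lemma sylvesterMap_surjective {p q : ℕ} {A : Matrix (Fin p) (Fin p) ℝ}
    {B : Matrix (Fin q) (Fin q) ℝ} {f g : Polynomial ℝ} (hfg : IsCoprime f g)
    (hf : Polynomial.aeval A f = 0) (hg : Polynomial.aeval B g = 0) :
    Function.Surjective (sylvesterMap A B) := by
  rw [← LinearMap.injective_iff_surjective, injective_iff_map_eq_zero]
  intro S hS
  have h : S * B = A * S := sub_eq_zero.1 hS
  obtain ⟨u, v, huv⟩ := hfg
  have h1 : S * Polynomial.aeval B (u * f + v * g) = 0 := by
    rw [mul_aeval_eq_aeval_mul h, map_add, map_mul, map_mul, hf, mul_zero, zero_add,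
      Matrix.mul_assoc, ← mul_aeval_eq_aeval_mul h, hg, Matrix.mul_zero, Matrix.mul_zero]
  simpa [huv] using h1

/-- The first coordinate functional is cyclic for a nonreal Jordan block: no nonzero invariant
subspace lies in its kernel. -/
lemma eq_zero_of_mem_invariant {lam : ℂ} (hb : lam.im ≠ 0) {r : ℕ} (hr : Even r)
    (W : Submodule ℝ (Fin r → ℝ)) (hW : ∀ w ∈ W, realJordanBlock r lam *ᵥ w ∈ W)
    (h0 : ∀ w ∈ W, seqExtend w 0 = 0) : ∀ w ∈ W, w = 0 := by
  have key : ∀ s : ℕ, ∀ w ∈ W, (∀ x, 2 * s ≤ x → seqExtend w x = 0) → w = 0 := by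
    intro s
    induction s with
    | zero =>
      intro w _ hx
      exact seqExtend_injective (funext fun x => by rw [hx x (by omega)]; simp [seqExtend])
    | succ s ih =>
      intro w hw hx
      have hN : Polynomial.aeval (realJordanBlock r lam) (conjRootsPoly lam) *ᵥ w = 0 := by
        refine ih _ ?_ ?_
        · rw [aeval_conjRootsPoly_mulVec]
          exact W.add_mem (W.add_mem (hW _ (hW _ hw)) (W.smul_mem _ (hW _ hw))) (W.smul_mem _ hw)
        · intro x hxs
          rw [seqExtend_aeval_conjRootsPoly_mulVec (fun _ => hr), if_neg hb]
          split_ifs with h2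
          · rw [hx _ (by omega), hx _ (by omega)]; simp
          · rw [hx _ (by omega), hx _ (by omega)]; simp
      have hNx : ∀ x, seqExtend
          (Polynomial.aeval (realJordanBlock r lam) (conjRootsPoly lam) *ᵥ w) x = 0 := by
        intro x
        rw [hN]
        simp [seqExtend]
      apply ih w hw
      intro x hxs
      by_cases hx2 : 2 * (s + 1) ≤ x
      · exact hx x hx2
      rcases Nat.eq_zero_or_pos s with rfl | hs
      · have hw0 := h0 w hw
        rcases (by omega : x = 0 ∨ x = 1) with rfl | rfl
        · exact hw0
        · have hJ := h0 _ (hW w hw)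
          rw [seqExtend_realJordanBlock_mulVec (fun _ => hr)] at hJ
          simp only [jordanOp, hb, if_false, Nat.zero_mod, if_true, zero_add, hw0,
            hx 2 (by omega)] at hJ
          simpa [hb] using hJ
      · rcases (by omega : x = 2 * s ∨ x = 2 * s + 1) with rfl | rfl
        · have h1 := hNx (2 * s - 1)
          rw [seqExtend_aeval_conjRootsPoly_mulVec (fun _ => hr), if_neg hb, if_neg (by omega),
            hx (2 * s - 1 + 4) (by omega), Nat.sub_add_cancel (by omega)] at h1
          simpa [hb] using h1
        · have h1 := hNx (2 * s - 2)
          rw [seqExtend_aeval_conjRootsPoly_mulVec (fun _ => hr), if_neg hb, if_pos (by omega),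
            hx (2 * s - 2 + 4) (by omega), (by omega : 2 * s - 2 + 3 = 2 * s + 1)] at h1
          simpa [hb] using h1
  intro w hw
  exact key r w hw fun x hx => seqExtend_of_le _ (by omega)

/-- The matrices all of whose columns but the first vanish. -/
def firstColumnSubmodule (p q : ℕ) : Submodule ℝ (Matrix (Fin p) (Fin q) ℝ) where
  carrier := {H | ∀ (i : Fin p) (j : Fin q), (j : ℕ) ≠ 0 → H i j = 0}
  add_mem' ha hb i j hj := by simp [ha i j hj, hb i j hj]
  zero_mem' _ _ _ := rfl
  smul_mem' c _ ha i j hj := by simp [ha i j hj]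

/-- The `q × p` matrix with ones on the main diagonal. -/
def inclusionMatrix (q p : ℕ) : Matrix (Fin q) (Fin p) ℝ :=
  Matrix.of fun i j => if (i : ℕ) = j then 1 else 0

lemma seqExtend_inclusionMatrix_mulVec {p q : ℕ} (hpq : p ≤ q) (w : Fin p → ℝ) :
    seqExtend (inclusionMatrix q p *ᵥ w) = seqExtend w := by
  funext x
  by_cases hx : x < q
  · have h1 : seqExtend (inclusionMatrix q p *ᵥ w) x =
        ∑ y ∈ Finset.range p, (if y = x then 1 else 0) * seqExtend w y := by
      rw [← Fin.sum_univ_eq_sum_range (fun y => (if y = x then 1 else 0) * seqExtend w y)]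
      simp [seqExtend, hx, inclusionMatrix, Matrix.mulVec, dotProduct, eq_comm]
    rw [h1, sum_range_ite_mul_seqExtend, one_mul]
  · rw [seqExtend_of_le _ (by omega), seqExtend_of_le _ (by omega)]

lemma realJordanBlock_mul_inclusionMatrix {lam : ℂ} {p q : ℕ} (hp : Even p) (hq : Even q)
    (hpq : p ≤ q) :
    realJordanBlock q lam * inclusionMatrix q p = inclusionMatrix q p * realJordanBlock p lam := by
  apply Matrix.ext_of_mulVec_single
  intro i
  apply seqExtend_injective
  rw [← Matrix.mulVec_mulVec, ← Matrix.mulVec_mulVec, seqExtend_inclusionMatrix_mulVec hpq,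
    seqExtend_realJordanBlock_mulVec (fun _ => hq), seqExtend_realJordanBlock_mulVec (fun _ => hp),
    seqExtend_inclusionMatrix_mulVec hpq]

lemma trace_inclusionMatrix_mul {p q : ℕ} (hq : 0 < q) {H : Matrix (Fin p) (Fin q) ℝ}
    (hpq : p ≤ q) (hH : H ∈ firstColumnSubmodule p q) :
    (inclusionMatrix q p * H).trace = seqExtend (fun i => H i ⟨0, hq⟩) 0 := by
  rw [Matrix.trace, Finset.sum_eq_single ⟨0, hq⟩]
  · have h := congrFun (seqExtend_inclusionMatrix_mulVec hpq (fun i => H i ⟨0, hq⟩)) 0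
    rw [← h]
    simp [seqExtend, hq, Matrix.mul_apply, Matrix.mulVec, dotProduct]
  · intro j _ hj
    have hj0 : (j : ℕ) ≠ 0 := fun h => hj (Fin.ext h)
    simp [Matrix.mul_apply, fun i => hH i j hj0]
  · simp

lemma eq_zero_of_mem_range_of_mem_firstColumn {lam : ℂ} (hb : lam.im ≠ 0) {p q : ℕ}
    (hp : Even p) (hq : Even q) (hq0 : 0 < q) (hpq : p ≤ q) {H : Matrix (Fin p) (Fin q) ℝ}
    (hH : H ∈ LinearMap.range (sylvesterMap (realJordanBlock p lam) (realJordanBlock q lam)))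
    (hH1 : H ∈ firstColumnSubmodule p q) : H = 0 := by
  set A := realJordanBlock p lam with hA
  set B := realJordanBlock q lam with hB
  let W : Submodule ℝ (Fin p → ℝ) :=
    (LinearMap.range (sylvesterMap A B) ⊓ firstColumnSubmodule p q).map
      (Matrix.mulVecBilin ℝ ℝ |>.flip (Pi.single ⟨0, hq0⟩ 1))
  have col : ∀ K : Matrix (Fin p) (Fin q) ℝ, K *ᵥ (Pi.single ⟨0, hq0⟩ 1) =
      fun i => K i ⟨0, hq0⟩ := by
    intro K
    ext i
    simp
  have hzero : ∀ w ∈ W, w = 0 := by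
    apply eq_zero_of_mem_invariant hb hp W
    · rintro w ⟨K, ⟨⟨S, hS⟩, hK⟩, rfl⟩
      refine ⟨A * K, ⟨⟨A * S, ?_⟩, ?_⟩, ?_⟩
      · rw [← hS, sylvesterMap_apply, sylvesterMap_apply, Matrix.mul_sub, Matrix.mul_assoc]
      · intro i j hj
        simp [Matrix.mul_apply, fun k => hK k j hj]
      · simp [← hA]
    · rintro w ⟨K, ⟨⟨S, hS⟩, hK⟩, rfl⟩
      have h1 : (inclusionMatrix q p * K).trace = 0 := by
        rw [← hS, sylvesterMap_apply, Matrix.mul_sub, Matrix.trace_sub, ← Matrix.mul_assoc,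
          Matrix.trace_mul_comm, ← Matrix.mul_assoc, ← Matrix.mul_assoc, hB, hA,
          realJordanBlock_mul_inclusionMatrix hp hq hpq, sub_self]
      rw [trace_inclusionMatrix_mul hq0 hpq hK, ← col] at h1
      exact h1
  have h2 := hzero _ ⟨H, ⟨hH, hH1⟩, rfl⟩
  have h3 : (fun i => H i ⟨0, hq0⟩) = 0 := by rw [← col]; exact h2
  ext i j
  by_cases hj : (j : ℕ) = 0
  · obtain rfl : j = ⟨0, hq0⟩ := Fin.ext hj
    exact congrFun h3 i
  · exact hH1 i j hj

lemma range_sylvesterMap_sup_firstColumn {lam : ℂ} (hb : lam.im ≠ 0) {p q : ℕ}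
    (hq : Even q) :
    LinearMap.range (sylvesterMap (realJordanBlock p lam) (realJordanBlock q lam)) ⊔
      firstColumnSubmodule p q = ⊤ := by
  set A := realJordanBlock p lam with hA
  set B := realJordanBlock q lam with hB
  by_contra hne
  obtain ⟨f, hf0, hf⟩ := Submodule.exists_le_ker_of_lt_top _ (lt_top_iff_ne_top.2 hne)
  let X : Matrix (Fin q) (Fin p) ℝ := Matrix.of fun j i => f (Matrix.single i j 1)
  have hfX : ∀ K, f K = (X * K).trace := by
    intro K
    have h : f = (Matrix.traceLinearMap (Fin q) ℝ ℝ) ∘ₗ (mulLeftLinearMap (Fin q) ℝ X) := by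
      apply Matrix.ext_linearMap
      intro i j
      ext
      simp [X, Matrix.trace_mul_single]
    rw [h]
    rfl
  have hcomm : B * X = X * A := by
    rw [Matrix.ext_iff_trace_mul_right]
    intro S
    have h1 : f (sylvesterMap A B S) = 0 :=
      hf (Submodule.mem_sup_left (LinearMap.mem_range_self _ S))
    rw [hfX, sylvesterMap_apply, Matrix.mul_sub, Matrix.trace_sub, sub_eq_zero,
      ← Matrix.mul_assoc, Matrix.trace_mul_comm, ← Matrix.mul_assoc, ← Matrix.mul_assoc] at h1
    exact h1
  have hXrange := eq_zero_of_mem_invariant hb hq (LinearMap.range X.mulVecLin)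
    (by
      rintro w ⟨u, rfl⟩
      refine ⟨A *ᵥ u, ?_⟩
      simp only [Matrix.mulVecLin_apply, Matrix.mulVec_mulVec]
      rw [← hcomm])
    (by
      rintro w ⟨u, rfl⟩
      by_cases hq0 : 0 < q
      · have hrow : ∀ i, X ⟨0, hq0⟩ i = 0 := by
          intro i
          refine hf (Submodule.mem_sup_right ?_)
          intro i' j hj
          refine Matrix.single_apply_of_ne _ _ _ _ _ ?_
          rintro ⟨-, rfl⟩
          exact hj rfl
        simp [seqExtend, hq0, Matrix.mulVec, dotProduct, hrow]
      · exact seqExtend_of_le _ (by omega))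
  have hX : X = 0 := by
    apply Matrix.ext_of_mulVec_single
    intro i
    rw [Matrix.zero_mulVec]
    exact hXrange _ ⟨_, rfl⟩
  exact hf0 (LinearMap.ext fun K => by rw [hfX, hX]; simp)

/-- Transposition along the anti-diagonal. -/
def antiTranspose {p q : ℕ} (M : Matrix (Fin p) (Fin q) ℝ) : Matrix (Fin q) (Fin p) ℝ :=
  Mᵀ.submatrix Fin.rev Fin.rev

lemma antiTranspose_antiTranspose {p q : ℕ} (M : Matrix (Fin p) (Fin q) ℝ) :
    antiTranspose (antiTranspose M) = M := by
  ext i j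
  simp [antiTranspose]

lemma antiTranspose_mul {p q r : ℕ} (M : Matrix (Fin p) (Fin q) ℝ)
    (K : Matrix (Fin q) (Fin r) ℝ) :
    antiTranspose (M * K) = antiTranspose K * antiTranspose M := by
  rw [antiTranspose, Matrix.transpose_mul]
  exact (Matrix.submatrix_mul_equiv Kᵀ Mᵀ Fin.rev Fin.revPerm Fin.rev).symm

lemma antiTranspose_realJordanBlock {lam : ℂ} (hb : lam.im ≠ 0) {r : ℕ} (hr : Even r) :
    antiTranspose (realJordanBlock r lam) = realJordanBlock r lam := by
  obtain ⟨s, hs⟩ := hr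
  ext i j
  have hi := i.isLt
  have hj := j.isLt
  simp only [antiTranspose, Matrix.submatrix_apply, Matrix.transpose_apply, realJordanBlock,
    Matrix.of_apply, Fin.val_rev, realJordanEntry, if_neg hb]
  split_ifs <;> first | omega | rfl

lemma antiTranspose_sylvesterMap {lam : ℂ} (hb : lam.im ≠ 0) {p q : ℕ} (hp : Even p)
    (hq : Even q) (S : Matrix (Fin p) (Fin q) ℝ) :
    antiTranspose (sylvesterMap (realJordanBlock p lam) (realJordanBlock q lam) S) =
      sylvesterMap (realJordanBlock q lam) (realJordanBlock p lam) (-antiTranspose S) := by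
  have h : ∀ K L : Matrix (Fin p) (Fin q) ℝ,
      antiTranspose (K - L) = antiTranspose K - antiTranspose L := fun _ _ => rfl
  rw [sylvesterMap_apply, sylvesterMap_apply, h, antiTranspose_mul, antiTranspose_mul,
    antiTranspose_realJordanBlock hb hp, antiTranspose_realJordanBlock hb hq, Matrix.neg_mul,
    Matrix.mul_neg]
  abel

/-- The matrices satisfying `IsForm51`, as a subspace. -/
def form51Submodule (p q : ℕ) : Submodule ℝ (Matrix (Fin p) (Fin q) ℝ) where
  carrier := {H | IsForm51 H}
  add_mem' {a b} ha hb := by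
    simp only [Set.mem_ofPred_eq, IsForm51] at *
    split_ifs at * <;> exact fun i j h => by simp [ha i j h, hb i j h]
  zero_mem' := by
    simp only [Set.mem_ofPred_eq, IsForm51]
    split_ifs <;> exact fun _ _ _ => rfl
  smul_mem' c a ha := by
    simp only [Set.mem_ofPred_eq, IsForm51] at *
    split_ifs at * <;> exact fun i j h => by simp [ha i j h]

lemma isForm51_iff_of_le {p q : ℕ} (hpq : p ≤ q) (H : Matrix (Fin p) (Fin q) ℝ) :
    IsForm51 H ↔ H ∈ firstColumnSubmodule p q := by
  rw [IsForm51, if_pos hpq]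
  rfl

lemma isForm51_iff_of_lt {p q : ℕ} (hpq : q < p) (H : Matrix (Fin p) (Fin q) ℝ) :
    IsForm51 H ↔ antiTranspose H ∈ firstColumnSubmodule q p := by
  rw [IsForm51, if_neg (not_le.2 hpq)]
  constructor
  · intro h i j hj
    refine h (Fin.rev j) (Fin.rev i) ?_
    rw [Fin.val_rev]
    omega
  · intro h i j hi
    have := h (Fin.rev j) (Fin.rev i) (by rw [Fin.val_rev]; omega)
    simpa [antiTranspose] using this

/-- The matrices satisfying `IsForm51` are a complement of the range of the Sylvester operator of two
Jordan blocks with the same nonreal eigenvalue. -/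
lemma isCompl_range_sylvesterMap_form51 {lam : ℂ} (hb : lam.im ≠ 0) {p q : ℕ} (hp : Even p)
    (hq : Even q) (hp0 : 0 < p) (hq0 : 0 < q) :
    IsCompl (LinearMap.range (sylvesterMap (realJordanBlock p lam) (realJordanBlock q lam)))
      (form51Submodule p q) := by
  rw [isCompl_iff, Submodule.disjoint_def, codisjoint_iff, Submodule.eq_top_iff']
  rcases le_or_gt p q with hpq | hpq
  · refine ⟨fun H hH hF => eq_zero_of_mem_range_of_mem_firstColumn hb hp hq hq0 hpq hH
      ((isForm51_iff_of_le hpq H).1 hF), fun M => ?_⟩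
    have hM : M ∈ (⊤ : Submodule ℝ (Matrix (Fin p) (Fin q) ℝ)) := trivial
    rw [← range_sylvesterMap_sup_firstColumn hb hq, Submodule.mem_sup] at hM
    obtain ⟨Y, hY, H, hH, rfl⟩ := hM
    exact Submodule.add_mem_sup hY ((isForm51_iff_of_le hpq H).2 hH)
  · refine ⟨?_, fun M => ?_⟩
    · rintro H ⟨S, rfl⟩ hF
      have h := eq_zero_of_mem_range_of_mem_firstColumn hb hq hp hp0 hpq.le
        ⟨_, (antiTranspose_sylvesterMap hb hp hq S).symm⟩ ((isForm51_iff_of_lt hpq _).1 hF)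
      rw [← antiTranspose_antiTranspose (sylvesterMap _ _ S), h]
      rfl
    · have hM : antiTranspose M ∈ (⊤ : Submodule ℝ (Matrix (Fin q) (Fin p) ℝ)) := trivial
      rw [← range_sylvesterMap_sup_firstColumn hb hp, Submodule.mem_sup] at hM
      obtain ⟨_, ⟨S, rfl⟩, H, hH, hSH⟩ := hM
      have h : M = antiTranspose (sylvesterMap (realJordanBlock q lam) (realJordanBlock p lam) S) +
          antiTranspose H := by
        rw [← antiTranspose_antiTranspose M, ← hSH]
        rfl
      rw [h, antiTranspose_sylvesterMap hb hq hp]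
      refine Submodule.add_mem_sup (LinearMap.mem_range_self _ _)
        ((isForm51_iff_of_lt hpq _).2 ?_)
      rwa [antiTranspose_antiTranspose]

/-- Lemma 5.1 of the paper for real Jordan blocks:
(1) if `λ ≠ μ` then every real `M` can be reduced to `0` by `M ↦ M + S J^ℝ_q(μ) − J^ℝ_p(λ) S`;
(2) if `λ = μ` is nonreal (with `Im λ > 0`), `p = 2m`, `q = 2n`, then every `M` can be
reduced to a matrix `H` of form (5.1), uniquely determined by `M`. -/
theorem real_jordan_sylvester_form51 (lam mu : ℂ)
    (hlam : 0 ≤ lam.im) (hmu : 0 ≤ mu.im) :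
    (∀ p q : ℕ, 1 ≤ p → 1 ≤ q → (0 < lam.im → Even p) → (0 < mu.im → Even q) →
      lam ≠ mu → ∀ M : Matrix (Fin p) (Fin q) ℝ, ∃ S : Matrix (Fin p) (Fin q) ℝ,
        M + S * realJordanBlock q mu - realJordanBlock p lam * S = 0) ∧
    (lam = mu → 0 < lam.im → ∀ m n : ℕ, 1 ≤ m → 1 ≤ n →
      ∀ M : Matrix (Fin (2 * m)) (Fin (2 * n)) ℝ,
        (∃ S H : Matrix (Fin (2 * m)) (Fin (2 * n)) ℝ, IsForm51 H ∧
            M + S * realJordanBlock (2 * n) lam - realJordanBlock (2 * m) lam * S = H) ∧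
        (∀ S H S' H' : Matrix (Fin (2 * m)) (Fin (2 * n)) ℝ,
            IsForm51 H → IsForm51 H' →
            M + S * realJordanBlock (2 * n) lam - realJordanBlock (2 * m) lam * S = H →
            M + S' * realJordanBlock (2 * n) lam - realJordanBlock (2 * m) lam * S' = H' →
            H = H')) := by
  have hcast {c : ℂ} (hc : 0 ≤ c.im) {r : ℕ} (h : 0 < c.im → Even r) : c.im ≠ 0 → Even r :=
    fun h0 => h (lt_of_le_of_ne hc h0.symm)
  refine ⟨fun p q _ _ hp hq hne M => ?_, ?_⟩
  · obtain ⟨S, hS⟩ := sylvesterMap_surjective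
      ((isCoprime_conjRootsPoly hlam hmu hne).pow (m := p) (n := q))
      (aeval_conjRootsPoly_pow_eq_zero (hcast hlam hp))
      (aeval_conjRootsPoly_pow_eq_zero (hcast hmu hq)) (-M)
    exact ⟨S, by rw [add_sub_assoc, ← sylvesterMap_apply, hS, add_neg_cancel]⟩
  · intro _ hb m n hm hn M
    have hcompl := isCompl_range_sylvesterMap_form51 hb.ne' (even_two_mul m) (even_two_mul n)
      (by omega) (by omega)
    constructor
    · have hM : M ∈ (⊤ : Submodule ℝ (Matrix (Fin (2 * m)) (Fin (2 * n)) ℝ)) := trivial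
      rw [← hcompl.sup_eq_top, Submodule.mem_sup] at hM
      obtain ⟨_, ⟨S, rfl⟩, H, hH, rfl⟩ := hM
      refine ⟨-S, H, hH, ?_⟩
      rw [add_sub_assoc, ← sylvesterMap_apply, map_neg]
      abel
    · intro S H S' H' hH hH' hS hS'
      rw [add_sub_assoc, ← sylvesterMap_apply] at hS hS'
      refine sub_eq_zero.1 (Submodule.disjoint_def.1 hcompl.disjoint _ ⟨S - S', ?_⟩
        ((form51Submodule _ _).sub_mem hH hH'))
      rw [map_sub, ← hS, ← hS']
      abel
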